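/- arXiv:1308.1387 — 5 statements merged into one kernel-verified Lean document; each statement's English description precedes it below -/
import Mathlib

section
/- Let Q : ℝ^n × ℝ^n → ℝ^n be bilinear and consider the map Ψ : ℝ^n × ℝ^n × ℝ^n × ℝ^n → ℝ^{4n} given by Ψ(x, x', t^{(1)}, t^{(2)}) := (x + t^{(1)}, x' + Q(x, t^{(1)}), x + t^{(2)}, x' + Q(x, t^{(2)})). Then the absolute value of the Jacobian determinant of Ψ at any point (x, x', t^{(1)}, t^{(2)}) equals |det Q(·, t^{(2)} − t^{(1)})|, the absolute value of the determinant of the linear map v ↦ Q(v, t^{(2)} − t^{(1)}) on ℝ^n. -/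
/-- A linear endomorphism of finite order has determinant of absolute value one. -/
theorem abs_det_eq_one_of_pow_eq_one {V : Type*} [AddCommGroup V] [Module ℝ V]
    (f : V →ₗ[ℝ] V) (k : ℕ) (hk : k ≠ 0) (hf : f ^ k = 1) : |LinearMap.det f| = 1 := by
  have h : |LinearMap.det f| ^ k = 1 := by
    rw [← abs_pow, ← map_pow, hf, map_one, abs_one]
  exact (pow_eq_one_iff_of_nonneg (abs_nonneg _) hk).1 h

/-- The linear map `(u, u', s₁, s₂) ↦ (u + s₁, u' + A u + B s₁, u + s₂, u' + A' u + B s₂)` has,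
up to sign, the determinant of `A' - A`. -/
theorem abs_det_eq_abs_det_sub {E : Type*} [AddCommGroup E] [Module ℝ E] [Module.Finite ℝ E]
    (A A' B : E →ₗ[ℝ] E) (L : (E × E × E × E) →ₗ[ℝ] (E × E × E × E))
    (hL : ∀ z, L z = (z.1 + z.2.2.1, z.2.1 + A z.1 + B z.2.2.1,
      z.1 + z.2.2.2, z.2.1 + A' z.1 + B z.2.2.2)) :
    |LinearMap.det L| = |LinearMap.det (A' - A)| := by
  let a : (E × E × E × E) →ₗ[ℝ] E := LinearMap.fst ℝ _ _
  let b : (E × E × E × E) →ₗ[ℝ] E := LinearMap.fst ℝ _ _ ∘ₗ LinearMap.snd ℝ _ _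
  let c : (E × E × E × E) →ₗ[ℝ] E :=
    LinearMap.fst ℝ _ _ ∘ₗ LinearMap.snd ℝ _ _ ∘ₗ LinearMap.snd ℝ _ _
  let d : (E × E × E × E) →ₗ[ℝ] E :=
    LinearMap.snd ℝ _ _ ∘ₗ LinearMap.snd ℝ _ _ ∘ₗ LinearMap.snd ℝ _ _
  let R : Module.End ℝ (E × E × E × E) := a.prod ((-b - (A - B) ∘ₗ a).prod ((-c - a).prod (-d - a)))
  let D : Module.End ℝ (E × E × E × E) := (A' - A).prodMap LinearMap.id
  let N : Module.End ℝ (E × E × E × E) := (-c).prod (b.prod ((-d).prod a))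
  let K : Module.End ℝ (E × E × E × E) := a.prod (b.prod (c.prod (b - d)))
  let S : Module.End ℝ (E × E × E × E) := a.prod ((B ∘ₗ a - b).prod (c.prod (B ∘ₗ c - d)))
  have hR : R ^ 2 = 1 := by
    refine LinearMap.ext fun z => ?_
    simp [R, a, b, c, d, pow_succ]
  have hN : N ^ 3 = 1 := by
    refine LinearMap.ext fun z => ?_
    simp [N, a, b, c, d, pow_succ]
  have hK : K ^ 2 = 1 := by
    refine LinearMap.ext fun z => ?_
    simp [K, a, b, c, d, pow_succ]
  have hS : S ^ 2 = 1 := by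
    refine LinearMap.ext fun z => ?_
    simp [S, a, b, c, d, pow_succ]
  have hfac : L = S * K * N * D * R := by
    refine LinearMap.ext fun z => ?_
    rw [hL]
    refine Prod.ext ?_ (Prod.ext ?_ (Prod.ext ?_ ?_)) <;>
      simp [S, K, N, D, R, a, b, c, d] <;> abel
  have hD : LinearMap.det D = LinearMap.det (A' - A) := by
    simp [D, LinearMap.det_prodMap]
  rw [hfac]
  simp only [map_mul, abs_mul, hD, abs_det_eq_one_of_pow_eq_one R 2 two_ne_zero hR,
    abs_det_eq_one_of_pow_eq_one N 3 three_ne_zero hN,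
    abs_det_eq_one_of_pow_eq_one K 2 two_ne_zero hK,
    abs_det_eq_one_of_pow_eq_one S 2 two_ne_zero hS, one_mul, mul_one]


/-- for bilinear `Q`, the absolute Jacobian determinant of
`Ψ(x,x',t¹,t²) = (x+t¹, x'+Q(x,t¹), x+t², x'+Q(x,t²))` equals `|det Q(·, t² − t¹)|`, the
absolute determinant of the linear map `v ↦ Q(v, t² − t¹)`. -/
theorem jacobian_eq_det_flip (n : ℕ)
    (Q : (Fin n → ℝ) →ₗ[ℝ] (Fin n → ℝ) →ₗ[ℝ] (Fin n → ℝ))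
    (x x' t1 t2 : Fin n → ℝ) :
    |(fderiv ℝ (fun z : (Fin n → ℝ) × (Fin n → ℝ) × (Fin n → ℝ) × (Fin n → ℝ) =>
        ((z.1 + z.2.2.1, z.2.1 + Q z.1 z.2.2.1, z.1 + z.2.2.2, z.2.1 + Q z.1 z.2.2.2) :
          (Fin n → ℝ) × (Fin n → ℝ) × (Fin n → ℝ) × (Fin n → ℝ)))
        (x, x', t1, t2)).det|
      = |LinearMap.det (Q.flip (t2 - t1))| := by
  let q : (Fin n → ℝ) →L[ℝ] (Fin n → ℝ) →L[ℝ] (Fin n → ℝ) :=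
    LinearMap.toContinuousLinearMap (LinearMap.toContinuousLinearMap.toLinearMap ∘ₗ Q)
  have hq : ∀ u v, Q u v = q u v := fun _ _ => rfl
  let p : (Fin n → ℝ) × (Fin n → ℝ) × (Fin n → ℝ) × (Fin n → ℝ) := (x, x', t1, t2)
  have h1 := hasFDerivAt_fst (𝕜 := ℝ) (p := p)
  have hr := hasFDerivAt_snd (𝕜 := ℝ) (p := p)
  have h2 := hr.fst
  have h3 := hr.snd.fst
  have h4 := hr.snd.snd
  have h := (h1.add h3).prodMk ((h2.add (q.hasFDerivAt_of_bilinear h1 h3)).prodMk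
    ((h1.add h4).prodMk (h2.add (q.hasFDerivAt_of_bilinear h1 h4))))
  have hd := h.fderiv
  refine Eq.trans (congrArg (fun f => |ContinuousLinearMap.det f|) hd) ?_
  rw [map_sub]
  refine abs_det_eq_abs_det_sub (Q.flip t1) (Q.flip t2) (Q x) _ fun z => ?_
  refine Prod.ext ?_ (Prod.ext ?_ (Prod.ext ?_ ?_)) <;>
    simp [p, hq] <;> abel
end

section
/- Let Q : ℝ^n × ℝ^n → ℝ^n be bilinear and define Ψ(x, x', t^{(1)}, t^{(2)}) := (x + t^{(1)}, x' + Q(x, t^{(1)}), x + t^{(2)}, x' + Q(x, t^{(2)})). If (x, x', t^{(1)}, t^{(2)}) and (y, y', s^{(1)}, s^{(2)}) satisfy Ψ(x, x', t^{(1)}, t^{(2)}) = Ψ(y, y', s^{(1)}, s^{(2)}) and the linear map v ↦ Q(v, t^{(2)} − t^{(1)}) on ℝ^n is invertible, then (x, x', t^{(1)}, t^{(2)}) = (y, y', s^{(1)}, s^{(2)}); that is, Ψ has nondegenerate multiplicity one. -/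
/-- for bilinear `Q`, the map
`Ψ(x,x',t¹,t²) = (x+t¹, x'+Q(x,t¹), x+t², x'+Q(x,t²))` is injective on points at which the
linear map `v ↦ Q(v, t² − t¹)` is invertible (nondegenerate multiplicity one). -/
theorem multiplicity_one (n : ℕ)
    (Q : (Fin n → ℝ) →ₗ[ℝ] (Fin n → ℝ) →ₗ[ℝ] (Fin n → ℝ))
    (x x' t1 t2 y y' s1 s2 : Fin n → ℝ)
    (hinv : Function.Bijective fun v => Q v (t2 - t1))
    (h : ((x + t1, x' + Q x t1, x + t2, x' + Q x t2) :
            (Fin n → ℝ) × (Fin n → ℝ) × (Fin n → ℝ) × (Fin n → ℝ))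
         = (y + s1, y' + Q y s1, y + s2, y' + Q y s2)) :
    ((x, x', t1, t2) : (Fin n → ℝ) × (Fin n → ℝ) × (Fin n → ℝ) × (Fin n → ℝ))
      = (y, y', s1, s2) := by
  simp only [Prod.mk.injEq] at h ⊢
  obtain ⟨h1, h2, h3, h4⟩ := h
  have hs : s2 - s1 = t2 - t1 := by
    rw [← add_sub_add_left_eq_sub s2 s1 y, ← h3, ← h1, add_sub_add_left_eq_sub]
  have hxy : x = y := hinv.injective <| by
    calc Q x (t2 - t1) = (x' + Q x t2) - (x' + Q x t1) := by
          rw [map_sub, add_sub_add_left_eq_sub]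
      _ = Q y (s2 - s1) := by rw [h4, h2, map_sub, add_sub_add_left_eq_sub]
      _ = Q y (t2 - t1) := by rw [hs]
  subst hxy
  obtain rfl := add_left_cancel h1
  exact ⟨rfl, add_right_cancel h2, rfl, add_left_cancel h3⟩
end

section
/- Let n ≥ 1, let Q : ℝ^n × ℝ^n → ℝ^n be bilinear, and for u ∈ ℝ^n let Q_u(x,y) := Q(x,y) + (u_1 x_1 y_1, …, u_n x_n y_n). Define F(s) := ∫_0^1 |s|^{-1+ρ} ρ^{2n} dρ for s ∈ ℝ. Then ∫_{[-1,1]^n} ∫_{[-1,1]^n} F(|det Q_u(·, t)|) dt du ≤ 2^{2n}, where det Q_u(·,t) is the determinant of the linear map v ↦ Q_u(v,t). -/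
open MeasureTheory
open scoped ENNReal

/-- `F(s) = ∫₀¹ |s|^{-1+ρ} ρ^{2n} dρ`, valued in `[0,∞]` (so `F(0) = ∞` is permitted). -/
noncomputable def Fint (n : ℕ) (s : ℝ) : ℝ≥0∞ :=
  ∫⁻ ρ in Set.Ioo (0 : ℝ) 1, ENNReal.ofReal |s| ^ (-1 + ρ) * ENNReal.ofReal (ρ ^ (2 * n))

/-- The linear map `v ↦ Q_u(v, t)`, where `Q_u(x,y) = Q(x,y) + (u₁x₁y₁, …, uₙxₙyₙ)`. -/
noncomputable def QuFlip {n : ℕ} (Q : (Fin n → ℝ) →ₗ[ℝ] (Fin n → ℝ) →ₗ[ℝ] (Fin n → ℝ))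
    (u t : Fin n → ℝ) : (Fin n → ℝ) →ₗ[ℝ] (Fin n → ℝ) :=
  Q.flip t + LinearMap.pi fun i => (u i * t i) • LinearMap.proj i

/-- Multiplicativity of `x ↦ |x| ^ p` as an `ℝ≥0∞`-valued function, for every real exponent. -/
lemma ofReal_abs_mul_rpow (x y p : ℝ) :
    ENNReal.ofReal |x * y| ^ p = ENNReal.ofReal |x| ^ p * ENNReal.ofReal |y| ^ p := by
  rw [abs_mul, ENNReal.ofReal_mul (abs_nonneg x),
    ENNReal.mul_rpow_of_ne_top ENNReal.ofReal_ne_top ENNReal.ofReal_ne_top]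

lemma lintegral_Ioc_abs_rpow {ρ : ℝ} (h0 : 0 < ρ) :
    ∫⁻ x in Set.Ioc (0 : ℝ) 1, ENNReal.ofReal |x| ^ (-1 + ρ) = ENNReal.ofReal (1 / ρ) := by
  have hr : (-1 : ℝ) < -1 + ρ := by linarith
  have h1 : ∫⁻ x in Set.Ioc (0 : ℝ) 1, ENNReal.ofReal |x| ^ (-1 + ρ)
      = ∫⁻ x in Set.Ioc (0 : ℝ) 1, ENNReal.ofReal (x ^ (-1 + ρ)) := by
    refine setLIntegral_congr_fun measurableSet_Ioc fun x hx => ?_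
    simp only [abs_of_pos hx.1, ENNReal.ofReal_rpow_of_pos hx.1]
  have hint := (intervalIntegral.intervalIntegrable_rpow' (a := 0) (b := 1) hr).1
  rw [h1, ← ofReal_integral_eq_lintegral_ofReal hint,
    ← intervalIntegral.integral_of_le zero_le_one, integral_rpow (Or.inl hr)]
  · congr 1
    have : -1 + ρ + 1 = ρ := by ring
    simp [this, Real.zero_rpow h0.ne']
  · filter_upwards [ae_restrict_mem measurableSet_Ioc] with x hx
    exact Real.rpow_nonneg hx.1.le _

lemma lintegral_Icc_abs_rpow_le {ρ : ℝ} (h0 : 0 < ρ) :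
    ∫⁻ x in Set.Icc (-1 : ℝ) 1, ENNReal.ofReal |x| ^ (-1 + ρ) ≤ ENNReal.ofReal (2 / ρ) := by
  have hneg : ∫⁻ x in Set.Ico (-1 : ℝ) 0, ENNReal.ofReal |x| ^ (-1 + ρ)
      = ENNReal.ofReal (1 / ρ) := by
    rw [← lintegral_Ioc_abs_rpow h0,
      ← (Measure.measurePreserving_neg (volume : Measure ℝ)).setLIntegral_comp_preimage_emb
        (MeasurableEquiv.neg ℝ).measurableEmbedding]
    simp
  have hsub : Set.Icc (-1 : ℝ) 1 ⊆ (Set.Ico (-1) 0 ∪ Set.Ioc 0 1) ∪ {0} := by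
    intro x hx
    rcases lt_trichotomy x 0 with h | h | h
    · exact Or.inl (Or.inl ⟨hx.1, h⟩)
    · exact Or.inr h
    · exact Or.inl (Or.inr ⟨h, hx.2⟩)
  calc _ ≤ ∫⁻ x in (Set.Ico (-1 : ℝ) 0 ∪ Set.Ioc 0 1) ∪ {0}, ENNReal.ofReal |x| ^ (-1 + ρ) :=
        lintegral_mono_set hsub
    _ ≤ ((∫⁻ x in Set.Ico (-1 : ℝ) 0, ENNReal.ofReal |x| ^ (-1 + ρ))
          + ∫⁻ x in Set.Ioc (0 : ℝ) 1, ENNReal.ofReal |x| ^ (-1 + ρ))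
          + ∫⁻ x in {(0 : ℝ)}, ENNReal.ofReal |x| ^ (-1 + ρ) :=
        (lintegral_union_le (fun x : ℝ => ENNReal.ofReal |x| ^ (-1 + ρ)) _ _).trans
          (add_le_add_left (lintegral_union_le _ _ _) _)
    _ = ENNReal.ofReal (2 / ρ) := by
        rw [hneg, lintegral_Ioc_abs_rpow h0,
          setLIntegral_measure_zero _ _ (measure_singleton (0 : ℝ)), add_zero,
          ← ENNReal.ofReal_add (by positivity) (by positivity)]
        congr 1
        ring

/-- A nonnegative function that is at least `1` on `B` and at most `1` off `B` has its largest
integral over sets of measure `μ B` at `B` itself. -/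
lemma setLIntegral_le_of_measure_eq {α : Type*} [MeasurableSpace α] {μ : Measure α}
    {A B : Set α} (hA : MeasurableSet A) (hB : MeasurableSet B) (hAB : μ A = μ B)
    (hfin : μ B ≠ ∞) {f : α → ℝ≥0∞} (hge : ∀ x ∈ B, 1 ≤ f x) (hle : ∀ x ∉ B, f x ≤ 1) :
    ∫⁻ x in A, f x ∂μ ≤ ∫⁻ x in B, f x ∂μ := by
  have hdiff : μ (A \ B) ≤ μ (B \ A) := by
    have h := measure_inter_add_sdiff (μ := μ) A hB
    rw [hAB, ← measure_inter_add_sdiff (μ := μ) B hA, Set.inter_comm B A] at h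
    exact ((ENNReal.add_right_inj (measure_ne_top_of_subset Set.inter_subset_right hfin)).1 h).le
  calc ∫⁻ x in A, f x ∂μ = ∫⁻ x in A ∩ B, f x ∂μ + ∫⁻ x in A \ B, f x ∂μ :=
        (lintegral_inter_add_sdiff f A hB).symm
    _ ≤ ∫⁻ x in B ∩ A, f x ∂μ + ∫⁻ x in B \ A, f x ∂μ := by
        rw [Set.inter_comm]
        refine add_le_add_right ?_ _
        calc ∫⁻ x in A \ B, f x ∂μ ≤ ∫⁻ _ in A \ B, 1 ∂μ :=
              setLIntegral_mono measurable_const fun x hx => hle x hx.2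
          _ = μ (A \ B) := setLIntegral_one _
          _ ≤ μ (B \ A) := hdiff
          _ = ∫⁻ _ in B \ A, 1 ∂μ := (setLIntegral_one _).symm
          _ ≤ ∫⁻ x in B \ A, f x ∂μ := setLIntegral_mono' (hB.diff hA) fun x hx => hge x hx.1
    _ = ∫⁻ x in B, f x ∂μ := lintegral_inter_add_sdiff f B hA

lemma lintegral_Icc_abs_add_rpow_le {ρ : ℝ} (h0 : 0 < ρ) (h1 : ρ < 1) (c : ℝ) :
    ∫⁻ x in Set.Icc (-1 : ℝ) 1, ENNReal.ofReal |x + c| ^ (-1 + ρ) ≤ ENNReal.ofReal (2 / ρ) := by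
  have hshift : ∫⁻ x in Set.Icc (-1 : ℝ) 1, ENNReal.ofReal |x + c| ^ (-1 + ρ)
      = ∫⁻ x in Set.Icc (-1 + c) (1 + c), ENNReal.ofReal |x| ^ (-1 + ρ) := by
    rw [← (measurePreserving_add_right (volume : Measure ℝ) c).setLIntegral_comp_preimage_emb
      (measurableEmbedding_addRight c) _ (Set.Icc (-1 + c) (1 + c))]
    simp
  rw [hshift]
  refine (setLIntegral_le_of_measure_eq measurableSet_Icc measurableSet_Icc ?_ ?_
    (fun x hx => ?_) (fun x hx => ?_)).trans (lintegral_Icc_abs_rpow_le h0)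
  · simp only [Real.volume_Icc]
    congr 1
    ring
  · simp
  · have hx1 : ENNReal.ofReal |x| ≤ 1 := ENNReal.ofReal_le_one.2 (abs_le.2 hx)
    simpa using ENNReal.rpow_le_rpow_of_exponent_ge hx1 (show -1 + ρ ≤ 0 by linarith)
  · have hx1 : 1 ≤ ENNReal.ofReal |x| := by
      rw [ENNReal.one_le_ofReal]
      by_contra! h
      exact hx (abs_le.1 h.le)
    simpa using ENNReal.rpow_le_rpow_of_exponent_le hx1 (show -1 + ρ ≤ 0 by linarith)

lemma lintegral_Icc_abs_affine_rpow_le {ρ : ℝ} (h0 : 0 < ρ) (h1 : ρ < 1) (a b : ℝ) :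
    ∫⁻ x in Set.Icc (-1 : ℝ) 1, ENNReal.ofReal |a + x * b| ^ (-1 + ρ)
      ≤ ENNReal.ofReal |b| ^ (-1 + ρ) * ENNReal.ofReal (2 / ρ) := by
  rcases eq_or_ne b 0 with rfl | hb
  · have h2 : ENNReal.ofReal (2 / ρ) ≠ 0 := by simpa using h0
    have hp : -1 + ρ < 0 := by linarith
    simp [ENNReal.zero_rpow_of_neg hp, ENNReal.top_mul h2]
  · have hfac : ∀ x, ENNReal.ofReal |a + x * b| ^ (-1 + ρ)
        = ENNReal.ofReal |b| ^ (-1 + ρ) * ENNReal.ofReal |x + a / b| ^ (-1 + ρ) := by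
      intro x
      rw [← ofReal_abs_mul_rpow]
      congr 3
      field_simp
      ring
    simp_rw [hfac]
    rw [lintegral_const_mul _ (by fun_prop)]
    gcongr
    exact lintegral_Icc_abs_add_rpow_le h0 h1 _

lemma volume_restrict_Icc_pi (n : ℕ) :
    (volume : Measure (Fin n → ℝ)).restrict (Set.Icc (-1) 1)
      = Measure.pi fun _ => (volume : Measure ℝ).restrict (Set.Icc (-1) 1) := by
  rw [← Measure.restrict_pi_pi, volume_pi]
  congr 1
  exact (Set.pi_univ_Icc (-1 : Fin n → ℝ) 1).symm

lemma lintegral_Icc_fin_succ {n : ℕ} {f : (Fin (n + 1) → ℝ) → ℝ≥0∞} (hf : Measurable f) :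
    ∫⁻ u in Set.Icc (-1 : Fin (n + 1) → ℝ) 1, f u
      = ∫⁻ v in Set.Icc (-1 : Fin n → ℝ) 1, ∫⁻ x in Set.Icc (-1 : ℝ) 1, f (Fin.cons x v) := by
  rw [volume_restrict_Icc_pi, volume_restrict_Icc_pi,
    ← (measurePreserving_piFinSuccAbove
      (fun _ : Fin (n + 1) => (volume : Measure ℝ).restrict (Set.Icc (-1) 1)) 0).symm.lintegral_comp
      hf, lintegral_prod_symm _ (by fun_prop)]
  simp [MeasurableEquiv.piFinSuccAbove_symm_apply, Fin.insertNthEquiv]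

/-- `det (M + diag (u t))` is affine in `u 0`, with slope `t 0` times the minor at `(0, 0)`. -/
lemma exists_det_add_diagonal_cons {n : ℕ} (M : Matrix (Fin (n + 1)) (Fin (n + 1)) ℝ)
    (t : Fin (n + 1) → ℝ) (v : Fin n → ℝ) :
    ∃ a : ℝ, ∀ x : ℝ, (M + Matrix.diagonal ((Fin.cons x v : Fin (n + 1) → ℝ) * t)).det
      = a + x * (t 0 *
        (M.submatrix Fin.succ Fin.succ + Matrix.diagonal (v * fun i : Fin n => t i.succ)).det) := by
  have hsub : ∀ (x : ℝ) (j : Fin (n + 1)),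
      (M + Matrix.diagonal ((Fin.cons x v : Fin (n + 1) → ℝ) * t)).submatrix Fin.succ j.succAbove
      = (M + Matrix.diagonal ((Fin.cons 0 v : Fin (n + 1) → ℝ) * t)).submatrix
        Fin.succ j.succAbove := by
    intro x j
    ext i k
    simp [Matrix.diagonal_apply]
  have hzero : (M + Matrix.diagonal ((Fin.cons 0 v : Fin (n + 1) → ℝ) * t)).submatrix
      Fin.succ Fin.succ
      = M.submatrix Fin.succ Fin.succ + Matrix.diagonal (v * fun i : Fin n => t i.succ) := by
    ext i k
    simp [Matrix.diagonal_apply]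
  refine ⟨(M + Matrix.diagonal ((Fin.cons 0 v : Fin (n + 1) → ℝ) * t)).det, fun x => ?_⟩
  rw [Matrix.det_succ_row_zero, Matrix.det_succ_row_zero (M + Matrix.diagonal
    ((Fin.cons 0 v : Fin (n + 1) → ℝ) * t))]
  simp_rw [hsub x]
  rw [Fin.sum_univ_succ, Fin.sum_univ_succ, Fin.succAbove_zero, hzero]
  simp [(Fin.succ_ne_zero _).symm]
  ring

lemma lintegral_det_add_diagonal_rpow_le {ρ : ℝ} (h0 : 0 < ρ) (h1 : ρ < 1) {n : ℕ}
    (M : Matrix (Fin n) (Fin n) ℝ) (t : Fin n → ℝ) :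
    ∫⁻ u in Set.Icc (-1 : Fin n → ℝ) 1,
        ENNReal.ofReal |(M + Matrix.diagonal (u * t)).det| ^ (-1 + ρ)
      ≤ ENNReal.ofReal |∏ i, t i| ^ (-1 + ρ) * ENNReal.ofReal (2 / ρ) ^ n := by
  induction n with
  | zero =>
    have := congrArg (fun μ => μ Set.univ) (volume_restrict_Icc_pi 0)
    simp at this ⊢
    simp [this]
  | succ n ih =>
    have hcont : ∀ {m : ℕ} (N : Matrix (Fin m) (Fin m) ℝ) (s : Fin m → ℝ),
        Measurable fun u : Fin m → ℝ =>
          ENNReal.ofReal |(N + Matrix.diagonal (u * s)).det| ^ (-1 + ρ) := by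
      intro m N s
      have : Continuous fun u : Fin m → ℝ => (N + Matrix.diagonal (u * s)).det := by fun_prop
      have := this.measurable
      fun_prop
    rw [lintegral_Icc_fin_succ (hcont M t)]
    set N := M.submatrix Fin.succ Fin.succ
    set s : Fin n → ℝ := fun i => t i.succ
    calc _ ≤ ∫⁻ v in Set.Icc (-1 : Fin n → ℝ) 1,
          (ENNReal.ofReal |t 0| ^ (-1 + ρ) * ENNReal.ofReal (2 / ρ)) *
            ENNReal.ofReal |(N + Matrix.diagonal (v * s)).det| ^ (-1 + ρ) := by
          refine lintegral_mono fun v => ?_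
          obtain ⟨a, ha⟩ := exists_det_add_diagonal_cons M t v
          simp_rw [ha]
          refine (lintegral_Icc_abs_affine_rpow_le h0 h1 _ _).trans_eq ?_
          rw [ofReal_abs_mul_rpow, mul_right_comm]
      _ ≤ (ENNReal.ofReal |t 0| ^ (-1 + ρ) * ENNReal.ofReal (2 / ρ)) *
            (ENNReal.ofReal |∏ i, s i| ^ (-1 + ρ) * ENNReal.ofReal (2 / ρ) ^ n) := by
          rw [lintegral_const_mul _ (hcont N s)]
          gcongr
          exact ih N s
      _ = _ := by
          rw [Fin.prod_univ_succ, ofReal_abs_mul_rpow, pow_succ]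
          ring

lemma lintegral_abs_prod_rpow_le {ρ : ℝ} (h0 : 0 < ρ) (h1 : ρ < 1) (n : ℕ) :
    ∫⁻ t in Set.Icc (-1 : Fin n → ℝ) 1, ENNReal.ofReal |∏ i, t i| ^ (-1 + ρ)
      ≤ ENNReal.ofReal (2 / ρ) ^ n := by
  simpa [Matrix.det_diagonal] using lintegral_det_add_diagonal_rpow_le h0 h1
    (0 : Matrix (Fin n) (Fin n) ℝ) 1

lemma det_QuFlip {n : ℕ} (Q : (Fin n → ℝ) →ₗ[ℝ] (Fin n → ℝ) →ₗ[ℝ] (Fin n → ℝ))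
    (u t : Fin n → ℝ) :
    LinearMap.det (QuFlip Q u t)
      = (LinearMap.toMatrix' (Q.flip t) + Matrix.diagonal (u * t)).det := by
  rw [← LinearMap.det_toMatrix', QuFlip, map_add]
  congr 2
  ext i j
  simp [LinearMap.toMatrix'_apply, Matrix.diagonal_apply, Pi.single_apply]

lemma continuous_det_QuFlip {n : ℕ} (Q : (Fin n → ℝ) →ₗ[ℝ] (Fin n → ℝ) →ₗ[ℝ] (Fin n → ℝ)) :
    Continuous fun p : (Fin n → ℝ) × (Fin n → ℝ) => LinearMap.det (QuFlip Q p.1 p.2) := by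
  have hM : Continuous fun t : Fin n → ℝ => LinearMap.toMatrix' (Q.flip t) :=
    (LinearMap.toMatrix'.toLinearMap ∘ₗ
      Q.flip).continuous_of_finiteDimensional
  simp_rw [det_QuFlip]
  have := hM.comp (continuous_snd (X := Fin n → ℝ))
  exact (this.add (by fun_prop)).matrix_det

/-- `∫_{[-1,1]ⁿ} ∫_{[-1,1]ⁿ} F(|det Q_u(·,t)|) dt du ≤ 2^{2n}`. -/
theorem double_integral_F_bound (n : ℕ) (hn : 1 ≤ n)
    (Q : (Fin n → ℝ) →ₗ[ℝ] (Fin n → ℝ) →ₗ[ℝ] (Fin n → ℝ)) :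
    (∫⁻ u in Set.Icc (-1 : Fin n → ℝ) 1, ∫⁻ t in Set.Icc (-1 : Fin n → ℝ) 1,
        Fint n |LinearMap.det (QuFlip Q u t)|) ≤ 2 ^ (2 * n) := by
  have hdet := (continuous_det_QuFlip Q).measurable
  have hmeas : Measurable fun p : ((Fin n → ℝ) × (Fin n → ℝ)) × ℝ =>
      ENNReal.ofReal |LinearMap.det (QuFlip Q p.1.1 p.1.2)| ^ (-1 + p.2) *
        ENNReal.ofReal (p.2 ^ (2 * n)) := by
    have : Measurable fun p : ((Fin n → ℝ) × (Fin n → ℝ)) × ℝ =>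
        LinearMap.det (QuFlip Q p.1.1 p.1.2) := hdet.comp measurable_fst
    fun_prop
  simp only [Fint, abs_abs]
  rw [lintegral_lintegral_swap (Measurable.lintegral_prod_right' hmeas).aemeasurable]
  calc _ = ∫⁻ t in Set.Icc (-1 : Fin n → ℝ) 1, ∫⁻ ρ in Set.Ioo (0 : ℝ) 1,
        ∫⁻ u in Set.Icc (-1 : Fin n → ℝ) 1,
          ENNReal.ofReal |LinearMap.det (QuFlip Q u t)| ^ (-1 + ρ) *
            ENNReal.ofReal (ρ ^ (2 * n)) := by
        refine lintegral_congr fun t => lintegral_lintegral_swap ?_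
        exact (hmeas.comp (f := fun q : (Fin n → ℝ) × ℝ => ((q.1, t), q.2))
          (by fun_prop)).aemeasurable
    _ ≤ ∫⁻ t in Set.Icc (-1 : Fin n → ℝ) 1, ∫⁻ ρ in Set.Ioo (0 : ℝ) 1,
          ENNReal.ofReal |∏ i, t i| ^ (-1 + ρ) *
            (ENNReal.ofReal (2 / ρ) ^ n * ENNReal.ofReal (ρ ^ (2 * n))) := by
        refine lintegral_mono fun t => setLIntegral_mono' measurableSet_Ioo fun ρ hρ => ?_
        have hu : Measurable fun u : Fin n → ℝ => LinearMap.det (QuFlip Q u t) :=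
          hdet.comp (f := fun u => (u, t)) (by fun_prop)
        rw [lintegral_mul_const _ (by fun_prop), ← mul_assoc]
        gcongr
        simp_rw [det_QuFlip]
        exact lintegral_det_add_diagonal_rpow_le hρ.1 hρ.2 _ t
    _ = ∫⁻ ρ in Set.Ioo (0 : ℝ) 1, ∫⁻ t in Set.Icc (-1 : Fin n → ℝ) 1,
          ENNReal.ofReal |∏ i, t i| ^ (-1 + ρ) *
            (ENNReal.ofReal (2 / ρ) ^ n * ENNReal.ofReal (ρ ^ (2 * n))) := by
        refine lintegral_lintegral_swap (Measurable.aemeasurable ?_)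
        simp only [Function.uncurry_def]
        fun_prop
    _ ≤ ∫⁻ _ in Set.Ioo (0 : ℝ) 1, 2 ^ (2 * n) := by
        refine setLIntegral_mono' measurableSet_Ioo fun ρ hρ => ?_
        have hρ0 : 0 < ρ := hρ.1
        rw [lintegral_mul_const _ (by fun_prop)]
        calc _ ≤ ENNReal.ofReal (2 / ρ) ^ n *
              (ENNReal.ofReal (2 / ρ) ^ n * ENNReal.ofReal (ρ ^ (2 * n))) := by
              gcongr
              exact lintegral_abs_prod_rpow_le hρ.1 hρ.2 n
          _ = 2 ^ (2 * n) := by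
              rw [← mul_assoc, ← pow_add, ← two_mul, ENNReal.ofReal_pow hρ0.le, ← mul_pow,
                ← ENNReal.ofReal_mul (by positivity), div_mul_cancel₀ _ hρ0.ne']
              simp
    _ = 2 ^ (2 * n) := by simp
end

section
/- Fix n ≥ 1 and define F(s) := ∫_0^1 |s|^{-1+ρ} ρ^{2n} dρ for s ∈ ℝ, s ≠ 0. Then for every θ ∈ (0,1) and every s ≠ 0, ( min{ (1-θ)^{2n+1}, 1 − (1-θ)^{2n+1} } / (2n+1) ) · |s|^{-θ} ≤ F(s). -/
open MeasureTheory
open scoped ENNReal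

theorem lintegral_Ioo_pow {a b : ℝ} (ha : 0 ≤ a) (hab : a ≤ b) (m : ℕ) :
    ∫⁻ x in Set.Ioo a b, ENNReal.ofReal (x ^ m) =
      ENNReal.ofReal ((b ^ (m + 1) - a ^ (m + 1)) / (m + 1)) := by
  rw [← integral_pow, intervalIntegral.integral_of_le hab, integral_Ioc_eq_integral_Ioo,
    ofReal_integral_eq_lintegral_ofReal]
  · exact ((continuous_pow m).integrableOn_Icc (a := a) (b := b)).mono_set Set.Ioo_subset_Icc_self
  · filter_upwards [ae_restrict_mem measurableSet_Ioo] with x hx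
    exact pow_nonneg (ha.trans hx.1.le) m

theorem ofReal_mul_le_Fint {n : ℕ} {s a b c : ℝ} (hs : s ≠ 0) (ha : 0 ≤ a) (hab : a ≤ b)
    (hb : b ≤ 1) (hc : 0 ≤ c) (h : ∀ ρ ∈ Set.Ioo a b, c ≤ |s| ^ (-1 + ρ)) :
    ENNReal.ofReal ((b ^ (2 * n + 1) - a ^ (2 * n + 1)) / (2 * n + 1) * c) ≤ Fint n s := by
  have hpow := lintegral_Ioo_pow ha hab (2 * n)
  push_cast at hpow
  rw [mul_comm, ENNReal.ofReal_mul hc, ← hpow,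
    ← lintegral_const_mul' _ _ ENNReal.ofReal_ne_top]
  calc ∫⁻ ρ in Set.Ioo a b, ENNReal.ofReal c * ENNReal.ofReal (ρ ^ (2 * n))
      ≤ ∫⁻ ρ in Set.Ioo a b, ENNReal.ofReal |s| ^ (-1 + ρ) * ENNReal.ofReal (ρ ^ (2 * n)) := by
        refine setLIntegral_mono' measurableSet_Ioo fun ρ hρ => ?_
        rw [ENNReal.ofReal_rpow_of_pos (abs_pos.mpr hs)]
        gcongr
        exact h ρ hρ
    _ ≤ Fint n s := lintegral_mono_set (Set.Ioo_subset_Ioo ha hb)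

/-- for every `θ ∈ (0,1)` and `s ≠ 0`,
`min((1-θ)^{2n+1}, 1-(1-θ)^{2n+1})/(2n+1) · |s|^{-θ} ≤ F(s)`. -/
theorem F_lower_bound (n : ℕ) (hn : 1 ≤ n) (θ : ℝ) (hθ : θ ∈ Set.Ioo (0 : ℝ) 1)
    (s : ℝ) (hs : s ≠ 0) :
    ENNReal.ofReal
        (min ((1 - θ) ^ (2 * n + 1)) (1 - (1 - θ) ^ (2 * n + 1)) / (2 * n + 1) * |s| ^ (-θ))
      ≤ Fint n s := by
  obtain ⟨h0, h1⟩ := hθ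
  have hpos : 0 < |s| := abs_pos.mpr hs
  have hc : 0 ≤ |s| ^ (-θ) := Real.rpow_nonneg hpos.le _
  rcases le_total |s| 1 with hs1 | hs1
  · refine le_trans (ENNReal.ofReal_le_ofReal ?_) (ofReal_mul_le_Fint hs le_rfl
      (sub_nonneg.mpr h1.le) (sub_le_self 1 h0.le) hc fun ρ hρ =>
        Real.rpow_le_rpow_of_exponent_ge hpos hs1 (by linarith [hρ.2]))
    gcongr
    simp
  · refine le_trans (ENNReal.ofReal_le_ofReal ?_) (ofReal_mul_le_Fint hs
      (sub_nonneg.mpr h1.le) (sub_le_self 1 h0.le) le_rfl hc fun ρ hρ =>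
        Real.rpow_le_rpow_of_exponent_le hs1 (by linarith [hρ.1]))
    gcongr
    simp
end

section
/- Let m ≥ 1 be an integer and write m = 2^{4q+r} s with integers q ≥ 0, 0 ≤ r ≤ 3, and s odd. If 1 ≤ n' ≤ 8q + 2^r, then there EXIST real m×m matrices M_1, …, M_{n'} such that for every λ = (λ_1, …, λ_{n'}) ∈ ℝ^{n'} \ {0}, the matrix λ_1 M_1 + ⋯ + λ_{n'} M_{n'} is invertible. -/
open scoped Kronecker

theorem Matrix.neg_kronecker {l m n p R : Type*} [Ring R] (A : Matrix l m R) (B : Matrix n p R) :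
    (-A) ⊗ₖ B = -(A ⊗ₖ B) := by
  ext; simp

theorem Matrix.kronecker_neg {l m n p R : Type*} [Ring R] (A : Matrix l m R) (B : Matrix n p R) :
    A ⊗ₖ (-B) = -(A ⊗ₖ B) := by
  ext; simp

/-- A family of pairwise anticommuting square roots of `-1`. -/
def IsCliffordFamily {R ι : Type*} [Ring R] (A : ι → R) : Prop :=
  (∀ i, A i * A i = -1) ∧ ∀ i j, i ≠ j → A i * A j = -(A j * A i)

namespace IsCliffordFamily

theorem comp_injective {R ι κ : Type*} [Ring R] {A : ι → R} (hA : IsCliffordFamily A)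
    {f : κ → ι} (hf : Function.Injective f) : IsCliffordFamily (A ∘ f) :=
  ⟨fun i => hA.1 (f i), fun _ _ hij => hA.2 _ _ (hf.ne hij)⟩

theorem map {R S ι : Type*} [Ring R] [Ring S] {A : ι → R} (hA : IsCliffordFamily A)
    (f : R →+* S) : IsCliffordFamily (f ∘ A) := by
  refine ⟨fun i => ?_, fun i j hij => ?_⟩
  · simp [← map_mul, hA.1]
  · simp only [Function.comp_apply, ← map_mul, ← map_neg, hA.2 i j hij]

theorem of_isEmpty {R ι : Type*} [Ring R] [IsEmpty ι] (A : ι → R) : IsCliffordFamily A :=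
  ⟨isEmptyElim, isEmptyElim⟩

theorem sum_smul_mul_self {R ι : Type*} [Ring R] [Algebra ℝ R] [Fintype ι] {A : ι → R}
    (hA : IsCliffordFamily A) (l : ι → ℝ) :
    (∑ i, l i • A i) * (∑ i, l i • A i) = -algebraMap ℝ R (∑ i, l i ^ 2) := by
  classical
  have key : ∀ t : Finset ι, (∑ i ∈ t, l i • A i) * (∑ i ∈ t, l i • A i) =
      -algebraMap ℝ R (∑ i ∈ t, l i ^ 2) := by
    intro t
    induction t using Finset.induction_on with
    | empty => simp
    | insert a t ha ih =>
      have hanti : (l a • A a) * (∑ i ∈ t, l i • A i) =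
          -((∑ i ∈ t, l i • A i) * (l a • A a)) := by
        rw [Finset.mul_sum, Finset.sum_mul, ← Finset.sum_neg_distrib]
        refine Finset.sum_congr rfl fun i hi => ?_
        have hai : a ≠ i := fun h => ha (h ▸ hi)
        rw [smul_mul_smul_comm, smul_mul_smul_comm, hA.2 a i hai, smul_neg, mul_comm]
      have hsq : (l a • A a) * (l a • A a) = -algebraMap ℝ R (l a ^ 2) := by
        rw [smul_mul_smul_comm, hA.1, smul_neg, Algebra.algebraMap_eq_smul_one, sq]
      rw [Finset.sum_insert ha, Finset.sum_insert ha, add_mul, mul_add, mul_add, ih, hanti, hsq,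
        map_add]
      abel
  exact key Finset.univ

theorem isUnit_smul_one_add_sum {R ι : Type*} [Ring R] [Algebra ℝ R] [Fintype ι] {A : ι → R}
    (hA : IsCliffordFamily A) (a : ℝ) (l : ι → ℝ) (h : a ≠ 0 ∨ l ≠ 0) :
    IsUnit (a • (1 : R) + ∑ i, l i • A i) := by
  set X := ∑ i, l i • A i
  have hX2 : X * X = -algebraMap ℝ R (∑ i, l i ^ 2) := hA.sum_smul_mul_self l
  have hpos : a ^ 2 + ∑ i, l i ^ 2 ≠ 0 := by
    have hnonneg : 0 ≤ ∑ i, l i ^ 2 := Finset.sum_nonneg fun i _ => sq_nonneg _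
    rcases h with ha | hl
    · positivity
    · obtain ⟨i, hi⟩ := Function.ne_iff.mp hl
      have hle : l i ^ 2 ≤ ∑ j, l j ^ 2 :=
        Finset.single_le_sum (fun j _ => sq_nonneg (l j)) (Finset.mem_univ i)
      have : 0 < l i ^ 2 := sq_pos_of_ne_zero hi
      nlinarith [sq_nonneg a]
  have hunit : IsUnit (algebraMap ℝ R (a ^ 2 + ∑ i, l i ^ 2)) :=
    (isUnit_iff_ne_zero.mpr hpos).map _
  have hcomm : Commute (a • (1 : R) + X) (a • (1 : R) - X) := by
    have h1 : Commute (a • (1 : R)) X := (Commute.one_left X).smul_left a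
    exact ((Commute.refl _).sub_right h1).add_left (h1.symm.sub_right (Commute.refl X))
  have hprod : (a • (1 : R) + X) * (a • (1 : R) - X) =
      algebraMap ℝ R (a ^ 2 + ∑ i, l i ^ 2) := by
    simp only [add_mul, mul_sub, hX2, map_add, smul_one_mul, mul_smul_one, sq,
      Algebra.algebraMap_eq_smul_one, smul_add, smul_smul]
    abel
  rw [← hprod, hcomm.isUnit_mul_iff] at hunit
  exact hunit.1

theorem sumElim {R ι κ : Type*} [Ring R] {A : ι → R} {B : κ → R} (hA : IsCliffordFamily A)
    (hB : IsCliffordFamily B) (hAB : ∀ i j, A i * B j = -(B j * A i)) :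
    IsCliffordFamily (Sum.elim A B) := by
  refine ⟨Sum.rec hA.1 hB.1, ?_⟩
  rintro (i | i) (j | j) hij
  · exact hA.2 i j fun h => hij (congrArg _ h)
  · exact hAB i j
  · simp [hAB j i]
  · exact hB.2 i j fun h => hij (congrArg _ h)

section Kronecker

variable {m n ι : Type*} [Fintype m] [DecidableEq m] [Fintype n] [DecidableEq n]

theorem kronecker_involution {A : ι → Matrix m m ℝ} (hA : IsCliffordFamily A)
    {P : Matrix n n ℝ} (hP : P * P = 1) : IsCliffordFamily fun i => A i ⊗ₖ P := by
  refine ⟨fun i => ?_, fun i j hij => ?_⟩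
  · rw [← Matrix.mul_kronecker_mul, hA.1, hP, Matrix.neg_kronecker, Matrix.one_kronecker_one]
  · rw [← Matrix.mul_kronecker_mul, ← Matrix.mul_kronecker_mul, hA.2 i j hij,
      Matrix.neg_kronecker]

theorem one_kronecker {B : ι → Matrix n n ℝ} (hB : IsCliffordFamily B) :
    IsCliffordFamily fun i => (1 : Matrix m m ℝ) ⊗ₖ B i := by
  refine ⟨fun i => ?_, fun i j hij => ?_⟩
  · rw [← Matrix.mul_kronecker_mul, hB.1, one_mul, Matrix.kronecker_neg,
      Matrix.one_kronecker_one]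
  · rw [← Matrix.mul_kronecker_mul, ← Matrix.mul_kronecker_mul, hB.2 i j hij,
      Matrix.kronecker_neg]

theorem sumElim_kronecker {κ : Type*} {A : ι → Matrix m m ℝ} {B : κ → Matrix n n ℝ}
    {P : Matrix n n ℝ} (hA : IsCliffordFamily A) (hB : IsCliffordFamily B) (hP : P * P = 1)
    (hBP : ∀ i, B i * P = -(P * B i)) :
    IsCliffordFamily (Sum.elim (fun i => A i ⊗ₖ P) fun i => 1 ⊗ₖ B i) :=
  (hA.kronecker_involution hP).sumElim hB.one_kronecker fun i j => by
    simp [← Matrix.mul_kronecker_mul, hBP, Matrix.kronecker_neg]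

end Kronecker

end IsCliffordFamily

/-- There are `k` anticommuting complex structures on `ℝ^N`. -/
def HasCliffordFamily (N k : ℕ) : Prop :=
  ∃ A : Fin k → Matrix (Fin N) (Fin N) ℝ, IsCliffordFamily A

theorem IsCliffordFamily.hasCliffordFamily {n ι : Type*} [Fintype n] [DecidableEq n] [Fintype ι]
    {A : ι → Matrix n n ℝ} (hA : IsCliffordFamily A) {N k : ℕ} (hN : Fintype.card n = N)
    (hk : k ≤ Fintype.card ι) : HasCliffordFamily N k := by
  obtain ⟨f⟩ : Nonempty (Fin k ↪ ι) := Function.Embedding.nonempty_of_card_le (by simpa using hk)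
  exact ⟨_, (hA.comp_injective f.injective).map
    (Matrix.reindexAlgEquiv ℝ ℝ (Fintype.equivFinOfCardEq hN)).toRingEquiv.toRingHom⟩

namespace RadonHurwitz

/-- Rotation by a quarter turn. -/
def rot : Matrix (Fin 2) (Fin 2) ℝ := !![0, 1; -1, 0]

/-- The coordinate swap. -/
def swap : Matrix (Fin 2) (Fin 2) ℝ := !![0, 1; 1, 0]

/-- Reflection in the first axis. -/
def refl : Matrix (Fin 2) (Fin 2) ℝ := !![1, 0; 0, -1]

theorem rot_mul_rot : rot * rot = -1 := by
  ext i j; fin_cases i <;> fin_cases j <;> simp [rot]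

theorem swap_mul_swap : swap * swap = 1 := by
  ext i j; fin_cases i <;> fin_cases j <;> simp [swap]

theorem refl_mul_refl : refl * refl = 1 := by
  ext i j; fin_cases i <;> fin_cases j <;> simp [refl]

theorem refl_mul_swap : refl * swap = -(swap * refl) := by
  ext i j; fin_cases i <;> fin_cases j <;> simp [swap, refl]

theorem rot_mul_swap : rot * swap = -(swap * rot) := by
  ext i j; fin_cases i <;> fin_cases j <;> simp [rot, swap]

theorem rot_mul_refl : rot * refl = -(refl * rot) := by
  ext i j; fin_cases i <;> fin_cases j <;> simp [rot, refl]

theorem isCliffordFamily_rot : IsCliffordFamily fun _ : Unit => rot :=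
  ⟨fun _ => rot_mul_rot, fun _ _ hij => (hij (Subsingleton.elim _ _)).elim⟩

theorem isCliffordFamily_doubling {m ι ι' : Type*} [Fintype m] [DecidableEq m]
    {A : ι → Matrix m m ℝ} {A' : ι' → Matrix m m ℝ} (hA : IsCliffordFamily A)
    (hA' : IsCliffordFamily A') (hAA' : ∀ i j, Commute (A i) (A' j)) :
    IsCliffordFamily (Sum.elim (fun i => A i ⊗ₖ swap)
      (Sum.elim (fun i => A' i ⊗ₖ refl) fun _ : Unit => 1 ⊗ₖ rot)) :=
  (hA.kronecker_involution swap_mul_swap).sumElim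
    (hA'.sumElim_kronecker isCliffordFamily_rot refl_mul_refl fun _ => rot_mul_refl) <| by
      rintro i (j | j)
      · simp [← Matrix.mul_kronecker_mul, refl_mul_swap, (hAA' i j).eq, Matrix.kronecker_neg]
      · simp [← Matrix.mul_kronecker_mul, rot_mul_swap, Matrix.kronecker_neg]

/-- Left multiplication by the imaginary quaternion units, as matrices. -/
def quaternionLeft : Unit ⊕ Unit ⊕ Unit → Matrix (Fin 2 × Fin 2) (Fin 2 × Fin 2) ℝ :=
  Sum.elim (fun _ => rot ⊗ₖ swap) (Sum.elim (fun _ => rot ⊗ₖ refl) fun _ => 1 ⊗ₖ rot)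

/-- Right multiplication by the imaginary quaternion units, as matrices. -/
def quaternionRight : Unit ⊕ Unit ⊕ Unit → Matrix (Fin 2 × Fin 2) (Fin 2 × Fin 2) ℝ :=
  Sum.elim (fun _ => swap ⊗ₖ rot) (Sum.elim (fun _ => refl ⊗ₖ rot) fun _ => rot ⊗ₖ 1)

theorem isCliffordFamily_quaternionLeft : IsCliffordFamily quaternionLeft :=
  isCliffordFamily_doubling isCliffordFamily_rot isCliffordFamily_rot fun _ _ => Commute.refl _

theorem isCliffordFamily_quaternionRight : IsCliffordFamily quaternionRight := by
  convert isCliffordFamily_quaternionLeft.map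
    (Matrix.reindexAlgEquiv ℝ ℝ (Equiv.prodComm (Fin 2) (Fin 2))).toRingEquiv.toRingHom using 1
  funext i
  rcases i with i | i | i <;> ext ⟨a, b⟩ ⟨c, d⟩ <;>
    simp [quaternionLeft, quaternionRight, mul_comm]

theorem commute_quaternionLeft_quaternionRight (i j : Unit ⊕ Unit ⊕ Unit) :
    Commute (quaternionLeft i) (quaternionRight j) := by
  rcases i with i | i | i <;> rcases j with j | j | j <;>
    simp [quaternionLeft, quaternionRight, commute_iff_eq, ← Matrix.mul_kronecker_mul,
      rot_mul_swap, rot_mul_refl, Matrix.neg_kronecker, Matrix.kronecker_neg]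

/-- Seven anticommuting complex structures on `ℝ⁸`. -/
def octonionic : (Unit ⊕ Unit ⊕ Unit) ⊕ (Unit ⊕ Unit ⊕ Unit) ⊕ Unit →
    Matrix ((Fin 2 × Fin 2) × Fin 2) ((Fin 2 × Fin 2) × Fin 2) ℝ :=
  Sum.elim (fun i => quaternionLeft i ⊗ₖ swap)
    (Sum.elim (fun i => quaternionRight i ⊗ₖ refl) fun _ => 1 ⊗ₖ rot)

theorem isCliffordFamily_octonionic : IsCliffordFamily octonionic :=
  isCliffordFamily_doubling isCliffordFamily_quaternionLeft isCliffordFamily_quaternionRight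
    commute_quaternionLeft_quaternionRight

theorem hasCliffordFamily_two_pow {r : ℕ} (hr : r ≤ 3) : HasCliffordFamily (2 ^ r) (2 ^ r - 1) := by
  interval_cases r
  · exact (IsCliffordFamily.of_isEmpty fun _ : Empty => (0 : Matrix Unit Unit ℝ)).hasCliffordFamily
      (by simp) (by simp)
  · exact isCliffordFamily_rot.hasCliffordFamily (by simp) (by simp)
  · exact isCliffordFamily_quaternionLeft.hasCliffordFamily (by simp) (by simp)
  · exact isCliffordFamily_octonionic.hasCliffordFamily (by simp) (by simp)

/-- Eight anticommuting complex structures on `ℝ¹⁶`. They all anticommute with the involution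
`1 ⊗ₖ refl`. -/
theorem isCliffordFamily_sixteen :
    IsCliffordFamily (Sum.elim (fun i => octonionic i ⊗ₖ swap) fun _ : Unit => 1 ⊗ₖ rot) :=
  isCliffordFamily_octonionic.sumElim_kronecker isCliffordFamily_rot swap_mul_swap
    fun _ => rot_mul_swap

theorem _root_.HasCliffordFamily.sixteen_mul {N k : ℕ} (h : HasCliffordFamily N k) :
    HasCliffordFamily (16 * N) (k + 8) := by
  obtain ⟨A, hA⟩ := h
  refine (hA.sumElim_kronecker isCliffordFamily_sixteen (P := 1 ⊗ₖ refl) ?_ ?_).hasCliffordFamily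
    (by simp [mul_comm]) (by simp)
  · simp [← Matrix.mul_kronecker_mul, refl_mul_refl]
  · rintro (i | i) <;>
      simp [← Matrix.mul_kronecker_mul, refl_mul_swap, rot_mul_refl, Matrix.kronecker_neg]

theorem hasCliffordFamily_two_pow_add (q : ℕ) {r : ℕ} (hr : r ≤ 3) :
    HasCliffordFamily (2 ^ (4 * q + r)) (8 * q + (2 ^ r - 1)) := by
  induction q with
  | zero => simpa using hasCliffordFamily_two_pow hr
  | succ q ih =>
    convert ih.sixteen_mul using 1
    · ring
    · ring

end RadonHurwitz

theorem HasCliffordFamily.mul_right {N k : ℕ} (h : HasCliffordFamily N k) (s : ℕ) :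
    HasCliffordFamily (N * s) k := by
  obtain ⟨A, hA⟩ := h
  exact (hA.kronecker_involution (one_mul (1 : Matrix (Fin s) (Fin s) ℝ))).hasCliffordFamily
    (by simp) (by simp)

theorem HasCliffordFamily.exists_isUnit_sum {N k t : ℕ} (h : HasCliffordFamily N k)
    (ht : t ≤ k) : ∃ M : Fin (t + 1) → Matrix (Fin N) (Fin N) ℝ,
      ∀ l : Fin (t + 1) → ℝ, l ≠ 0 → IsUnit (∑ i, l i • M i) := by
  obtain ⟨A, hA⟩ := h
  refine ⟨Fin.cons 1 (A ∘ Fin.castLE ht), fun l hl => ?_⟩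
  rw [Fin.sum_univ_succ]
  refine (hA.comp_injective (Fin.castLE_injective ht)).isUnit_smul_one_add_sum (l 0)
    (fun i => l i.succ) ?_
  by_contra! h0
  exact hl (funext (Fin.cases h0.1 (congrFun h0.2)))


/-- Write `m = 2^(4q+r) s` with `s` odd and `0 ≤ r ≤ 3`.  If `1 ≤ n' ≤ 8q + 2^r`
(the Radon–Hurwitz number of `m`), then there exist real `m×m` matrices `M₁, …, M_{n'}` all of
whose nontrivial linear combinations are invertible. -/
theorem exists_nondegenerate_family_within_radon_hurwitz (m q r s n' : ℕ)
    (hm1 : 1 ≤ m) (hr : r ≤ 3) (hs : Odd s) (hm : m = 2 ^ (4 * q + r) * s)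
    (hn'1 : 1 ≤ n') (hn' : n' ≤ 8 * q + 2 ^ r) :
    ∃ M : Fin n' → Matrix (Fin m) (Fin m) ℝ,
      ∀ l : Fin n' → ℝ, l ≠ 0 → IsUnit (∑ i, l i • M i) := by
  subst hm
  obtain ⟨t, rfl⟩ := Nat.exists_eq_add_of_le' hn'1
  exact ((RadonHurwitz.hasCliffordFamily_two_pow_add q hr).mul_right s).exists_isUnit_sum
    (by omega)
end
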